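/- Let θ ∈ (0,1) and let α, β ∈ (0, 1−θ). If f_α ∈ F_α and f_β ∈ F_β are fixed points of T (i.e., T(f_α) = f_α and T(f_β) = f_β), then f_α = f_β almost everywhere; that is, the unique fixed point of T in F_α does not depend on the choice of α ∈ (0, 1−θ). -/

import Mathlib

open MeasureTheory Real Set

/-- The operator `T` from the integral equation for crossing probabilities. -/
noncomputable def T (θ : ℝ) (f : ℝ → ℝ) : ℝ → ℝ :=
  fun s => 1 - (1 - 1 / s) ^ θ +
    θ * (s - 1) ^ θ * ∫ t in Ioi (1 : ℝ), (s + t - 1) ^ (-θ - 1) * f t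

/-- Membership in the space `F_α`: `f` is measurable, takes values in `[0,1]` on
`[1,∞)`, and `sup_{s ≥ 1} s^α |f s| < ∞`. -/
def MemF (α : ℝ) (f : ℝ → ℝ) : Prop :=
  Measurable f ∧ (∀ s, 1 ≤ s → f s ∈ Icc (0 : ℝ) 1) ∧
    BddAbove ((fun s => s ^ α * |f s|) '' Ici 1)

open Filter Topology

lemma hasDerivAt_one_add_rpow {p u : ℝ} (hu : 0 < 1 + u) :
    HasDerivAt (fun u : ℝ => (1 + u) ^ p) (p * (1 + u) ^ (p - 1)) u := by
  simpa using ((hasDerivAt_id u).const_add 1).rpow_const (p := p) (Or.inl hu.ne')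

lemma tendsto_div_one_add_atTop : Tendsto (fun u : ℝ => u / (1 + u)) atTop (𝓝 1) := by
  have h : Tendsto (fun u : ℝ => 1 - (1 + u)⁻¹) atTop (𝓝 (1 - 0)) :=
    tendsto_const_nhds.sub (tendsto_inv_atTop_zero.comp (tendsto_atTop_add_const_left _ 1 tendsto_id))
  rw [sub_zero] at h
  refine h.congr' ?_
  filter_upwards [eventually_gt_atTop 0] with u hu
  field_simp
  simp

lemma hasDerivAt_neg_one_add_rpow_neg {θ u : ℝ} (hu : 0 < 1 + u) :
    HasDerivAt (fun u : ℝ => -(1 + u) ^ (-θ)) (θ * (1 + u) ^ (-θ - 1)) u :=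
  (hasDerivAt_one_add_rpow (p := -θ) hu).neg.congr_deriv (by ring)

lemma tendsto_neg_one_add_rpow_neg {θ : ℝ} (hθ : 0 < θ) :
    Tendsto (fun u : ℝ => -(1 + u) ^ (-θ)) atTop (𝓝 0) := by
  simpa using ((tendsto_rpow_neg_atTop hθ).comp
    (tendsto_atTop_add_const_left _ (1 : ℝ) tendsto_id)).neg

lemma integrableOn_one_add_rpow {θ : ℝ} (hθ : 0 < θ) :
    IntegrableOn (fun u : ℝ => θ * (1 + u) ^ (-θ - 1)) (Ioi 0) :=
  integrableOn_Ioi_deriv_of_nonneg'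
    (fun u hu => hasDerivAt_neg_one_add_rpow_neg (by linarith [mem_Ici.1 hu]))
    (fun u hu => by have := mem_Ioi.1 hu; positivity) (tendsto_neg_one_add_rpow_neg hθ)

lemma integral_one_add_rpow {θ : ℝ} (hθ : 0 < θ) :
    ∫ u in Ioi (0 : ℝ), θ * (1 + u) ^ (-θ - 1) = 1 := by
  rw [integral_Ioi_of_hasDerivAt_of_nonneg'
    (fun u hu => hasDerivAt_neg_one_add_rpow_neg (by linarith [mem_Ici.1 hu]))
    (fun u hu => by have := mem_Ioi.1 hu; positivity) (tendsto_neg_one_add_rpow_neg hθ)]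
  simp

lemma hasDerivAt_div_one_add_rpow {θ u : ℝ} (hu : 0 < u) :
    HasDerivAt (fun u : ℝ => (u / (1 + u)) ^ θ)
      (θ * (1 + u) ^ (-θ - 1) * u ^ (-(1 - θ))) u := by
  have hu' : 0 < 1 + u := by linarith
  have h := ((hasDerivAt_id u).div ((hasDerivAt_id u).const_add 1) hu'.ne').rpow_const
    (p := θ) (Or.inl (div_pos hu hu').ne')
  refine h.congr_deriv ?_
  simp only [id, Pi.div_apply]
  rw [div_rpow hu.le hu'.le, neg_sub, show -θ - 1 = -(θ - 1) - 2 by ring,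
    rpow_sub hu' (-(θ - 1)), rpow_neg hu'.le, rpow_two]
  field_simp
  ring

lemma continuousWithinAt_div_one_add_rpow {θ : ℝ} (hθ : 0 < θ) :
    ContinuousWithinAt (fun u : ℝ => (u / (1 + u)) ^ θ) (Ici 0) 0 := by
  refine ContinuousAt.continuousWithinAt (ContinuousAt.rpow_const ?_ (Or.inr hθ.le))
  exact continuousAt_id.div (continuousAt_const.add continuousAt_id) (by simp)

lemma tendsto_div_one_add_rpow (θ : ℝ) :
    Tendsto (fun u : ℝ => (u / (1 + u)) ^ θ) atTop (𝓝 1) := by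
  simpa using tendsto_div_one_add_atTop.rpow_const (p := θ) (Or.inl one_ne_zero)

lemma integrableOn_one_add_rpow_mul_rpow {θ : ℝ} (hθ : 0 < θ) :
    IntegrableOn (fun u : ℝ => θ * (1 + u) ^ (-θ - 1) * u ^ (-(1 - θ))) (Ioi 0) :=
  integrableOn_Ioi_deriv_of_nonneg (continuousWithinAt_div_one_add_rpow hθ)
    (fun _ hu => hasDerivAt_div_one_add_rpow hu)
    (fun u hu => by have := mem_Ioi.1 hu; positivity) (tendsto_div_one_add_rpow θ)

lemma integral_one_add_rpow_mul_rpow {θ : ℝ} (hθ : 0 < θ) :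
    ∫ u in Ioi (0 : ℝ), θ * (1 + u) ^ (-θ - 1) * u ^ (-(1 - θ)) = 1 := by
  rw [integral_Ioi_of_hasDerivAt_of_nonneg (continuousWithinAt_div_one_add_rpow hθ)
    (fun _ hu => hasDerivAt_div_one_add_rpow hu)
    (fun u hu => by have := mem_Ioi.1 hu; positivity) (tendsto_div_one_add_rpow θ)]
  simp [zero_rpow hθ.ne']

/-- Strict weighted AM-GM for the weights `1` and `u ^ (-(1 - θ))`. -/
lemma rpow_neg_lt_interpolation {θ γ u : ℝ} (hγ : γ ∈ Ioo (0 : ℝ) (1 - θ))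
    (hu : 0 < u) (hu1 : u ≠ 1) :
    u ^ (-γ) < 1 - γ / (1 - θ) + γ / (1 - θ) * u ^ (-(1 - θ)) := by
  have hθ : 0 < 1 - θ := hγ.1.trans hγ.2
  have hne : u ^ (-(1 - θ)) - 1 ≠ 0 := by
    intro h
    rw [sub_eq_zero] at h
    exact hu1 ((rpow_left_inj hu.le zero_le_one (by linarith)).1 (h.trans (one_rpow _).symm))
  have h := rpow_one_add_lt_one_add_mul_self (s := u ^ (-(1 - θ)) - 1)
    (by linarith [rpow_pos_of_pos hu (-(1 - θ))]) hne (div_pos hγ.1 hθ)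
    ((div_lt_one hθ).2 hγ.2)
  rw [add_sub_cancel, ← rpow_mul hu.le, neg_mul, mul_div_cancel₀ _ hθ.ne'] at h
  linarith

lemma rpow_neg_le_interpolation {θ γ u : ℝ} (hγ : γ ∈ Ioo (0 : ℝ) (1 - θ)) (hu : 0 < u) :
    u ^ (-γ) ≤ 1 - γ / (1 - θ) + γ / (1 - θ) * u ^ (-(1 - θ)) := by
  rcases eq_or_ne u 1 with rfl | h
  · simp
  · exact (rpow_neg_lt_interpolation hγ hu h).le

lemma integrableOn_interpolation {θ : ℝ} (hθ : 0 < θ) (p : ℝ) :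
    IntegrableOn (fun u : ℝ => θ * (1 + u) ^ (-θ - 1) * (1 - p + p * u ^ (-(1 - θ)))) (Ioi 0) := by
  refine (((integrableOn_one_add_rpow hθ).const_mul (1 - p)).add
    ((integrableOn_one_add_rpow_mul_rpow hθ).const_mul p)).congr (Eventually.of_forall fun u => ?_)
  simp only [Pi.add_apply]
  ring

lemma integral_interpolation {θ : ℝ} (hθ : 0 < θ) (p : ℝ) :
    ∫ u in Ioi (0 : ℝ), θ * (1 + u) ^ (-θ - 1) * (1 - p + p * u ^ (-(1 - θ))) = 1 := by
  have h := integral_add ((integrableOn_one_add_rpow hθ).const_mul (1 - p))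
    ((integrableOn_one_add_rpow_mul_rpow hθ).const_mul p)
  rw [integral_const_mul (1 - p), integral_const_mul p, integral_one_add_rpow hθ,
    integral_one_add_rpow_mul_rpow hθ] at h
  calc _ = _ := integral_congr_ae (Eventually.of_forall fun u => by ring)
    _ = _ := h
    _ = 1 := by ring

lemma integrableOn_kernel {θ γ : ℝ} (hθ : 0 < θ) (hγ : γ ∈ Ioo (0 : ℝ) (1 - θ)) :
    IntegrableOn (fun u : ℝ => θ * (1 + u) ^ (-θ - 1) * u ^ (-γ)) (Ioi 0) := by
  refine (integrableOn_interpolation hθ (γ / (1 - θ))).mono' (by fun_prop) ?_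
  filter_upwards [ae_restrict_mem measurableSet_Ioi] with u (hu : 0 < u)
  rw [norm_of_nonneg (by positivity)]
  exact mul_le_mul_of_nonneg_left (rpow_neg_le_interpolation hγ hu) (by positivity)

/-- The contraction constant: the Beta integral `θ B(1 - γ, θ + γ)` is less than one. -/
lemma integral_kernel_lt_one {θ γ : ℝ} (hθ : 0 < θ) (hγ : γ ∈ Ioo (0 : ℝ) (1 - θ)) :
    ∫ u in Ioi (0 : ℝ), θ * (1 + u) ^ (-θ - 1) * u ^ (-γ) < 1 := by
  refine lt_of_lt_of_eq ?_ (integral_interpolation hθ (γ / (1 - θ)))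
  rw [← sub_pos, ← integral_sub (integrableOn_interpolation hθ _) (integrableOn_kernel hθ hγ),
    integral_pos_iff_support_of_nonneg_ae _
      (Integrable.sub' (integrableOn_interpolation hθ _) (integrableOn_kernel hθ hγ))]
  · rw [Measure.restrict_apply' measurableSet_Ioi]
    refine lt_of_lt_of_le (b := volume (Ioo (0 : ℝ) 1)) (by simp) (measure_mono ?_)
    intro u hu
    have h0 : 0 < u := hu.1
    refine ⟨ne_of_gt (sub_pos.2 ?_), h0⟩
    exact mul_lt_mul_of_pos_left (rpow_neg_lt_interpolation hγ h0 hu.2.ne) (by positivity)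
  · filter_upwards [ae_restrict_mem measurableSet_Ioi] with u (hu : 0 < u)
    exact sub_nonneg.2
      (mul_le_mul_of_nonneg_left (rpow_neg_le_interpolation hγ hu) (by positivity))

lemma integral_Ioi_one_eq_mul_integral_Ioi_zero (g : ℝ → ℝ) {x : ℝ} (hx : 0 < x) :
    ∫ t in Ioi (1 : ℝ), g t = x * ∫ u in Ioi (0 : ℝ), g (x * u + 1) := by
  have h := integral_comp_mul_left_Ioi (fun y => g (y + 1)) 0 hx
  have h' := (measurePreserving_add_right volume (1 : ℝ)).setIntegral_preimage_emb
    (measurableEmbedding_addRight 1) g (Ioi 1)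
  have hpre : (fun y : ℝ => y + 1) ⁻¹' Ioi 1 = Ioi 0 := by ext; simp
  rw [hpre] at h'
  rw [h, mul_zero, h', smul_eq_mul, mul_inv_cancel_left₀ hx.ne']

lemma abs_integral_operator_le {θ γ M s : ℝ} (hθ : 0 < θ) (hγ : γ ∈ Ioo (0 : ℝ) (1 - θ))
    {h : ℝ → ℝ} (hM : ∀ t, 1 < t → (t - 1) ^ γ * |h t| ≤ M) (hs : 1 < s) :
    (s - 1) ^ γ * |θ * (s - 1) ^ θ * ∫ t in Ioi (1 : ℝ), (s + t - 1) ^ (-θ - 1) * h t| ≤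
      M * ∫ u in Ioi (0 : ℝ), θ * (1 + u) ^ (-θ - 1) * u ^ (-γ) := by
  obtain ⟨x, rfl⟩ : ∃ x, s = x + 1 := ⟨s - 1, by ring⟩
  have hx : 0 < x := by linarith
  have hM0 : 0 ≤ M := le_trans (by norm_num) (hM 2 (by norm_num))
  rw [integral_Ioi_one_eq_mul_integral_Ioi_zero _ hx, add_sub_cancel_right,
    ← abs_of_nonneg (rpow_nonneg hx.le γ), ← abs_mul,
    ← integral_const_mul x, ← integral_const_mul (θ * x ^ θ), ← integral_const_mul (x ^ γ),
    ← integral_const_mul M]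
  refine norm_integral_le_of_norm_le (G := ℝ) ((integrableOn_kernel hθ hγ).const_mul M) ?_
  filter_upwards [ae_restrict_mem measurableSet_Ioi] with u (hu : 0 < u)
  have hh := hM (x * u + 1) (by nlinarith [mul_pos hx hu])
  rw [add_sub_cancel_right, mul_rpow hx.le hu.le] at hh
  have hk : (x + 1 + (x * u + 1) - 1) ^ (-θ - 1) ≤ x ^ (-θ - 1) * (1 + u) ^ (-θ - 1) := by
    rw [← mul_rpow hx.le (by positivity)]
    exact rpow_le_rpow_of_nonpos (by positivity) (by linarith) (by linarith)
  have hpow : x ^ θ * x * x ^ (-θ - 1) = 1 := by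
    rw [← rpow_add_one hx.ne', ← rpow_add hx]
    simp
  have hbase : 0 ≤ x + 1 + (x * u + 1) - 1 := by nlinarith [mul_pos hx hu]
  have hhu : x ^ γ * |h (x * u + 1)| ≤ M * u ^ (-γ) := by
    rw [rpow_neg hu.le, ← div_eq_mul_inv, le_div_iff₀ (by positivity)]
    linarith
  rw [norm_eq_abs]
  simp only [abs_mul, abs_of_nonneg (rpow_nonneg hx.le _), abs_of_nonneg (rpow_nonneg hbase _),
    abs_of_pos hθ, abs_of_pos hx]
  calc _ = θ * (x ^ θ * x) * ((x + 1 + (x * u + 1) - 1) ^ (-θ - 1) *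
        (x ^ γ * |h (x * u + 1)|)) := by ring
    _ ≤ θ * (x ^ θ * x) * ((x ^ (-θ - 1) * (1 + u) ^ (-θ - 1)) * (M * u ^ (-γ))) := by gcongr
    _ = (x ^ θ * x * x ^ (-θ - 1)) * (M * (θ * (1 + u) ^ (-θ - 1) * u ^ (-γ))) := by ring
    _ = _ := by rw [hpow, one_mul]

lemma MemF.mono {α γ : ℝ} {f : ℝ → ℝ} (hf : MemF α f) (hγ : γ ≤ α) : MemF γ f := by
  obtain ⟨hm, h01, C, hC⟩ := hf
  refine ⟨hm, h01, C, ?_⟩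
  rintro _ ⟨s, hs, rfl⟩
  exact (mul_le_mul_of_nonneg_right (rpow_le_rpow_of_exponent_le hs hγ) (abs_nonneg _)).trans
    (hC ⟨s, hs, rfl⟩)

lemma MemF.integrableOn_kernel_mul {θ α s : ℝ} {f : ℝ → ℝ} (hf : MemF α f) (hθ : 0 < θ)
    (hs : 1 ≤ s) :
    IntegrableOn (fun t => (s + t - 1) ^ (-θ - 1) * f t) (Ioi 1) := by
  have hk : IntegrableOn (fun t : ℝ => (t + (s - 1)) ^ (-θ - 1)) (Ioi 1) :=
    integrableOn_add_rpow_Ioi_of_lt (by linarith) (by linarith)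
  have := hf.1
  refine hk.mono' (by fun_prop) ?_
  filter_upwards [ae_restrict_mem measurableSet_Ioi] with t (ht : 1 < t)
  have hft := hf.2.1 t ht.le
  have hb : 0 ≤ s + t - 1 := by linarith
  rw [norm_mul, norm_of_nonneg (rpow_nonneg hb _), norm_of_nonneg hft.1,
    show t + (s - 1) = s + t - 1 by ring]
  exact mul_le_of_le_one_right (rpow_nonneg hb _) hft.2

lemma T_sub_T {θ α s : ℝ} {f g : ℝ → ℝ} (hf : MemF α f) (hg : MemF α g) (hθ : 0 < θ)
    (hs : 1 ≤ s) :
    T θ f s - T θ g s =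
      θ * (s - 1) ^ θ * ∫ t in Ioi (1 : ℝ), (s + t - 1) ^ (-θ - 1) * (f t - g t) := by
  simp only [T, mul_sub (_ ^ (-θ - 1))]
  rw [integral_sub (hf.integrableOn_kernel_mul hθ hs) (hg.integrableOn_kernel_mul hθ hs)]
  ring

/-- Two fixed points of `T` in the same space `F_γ` agree on `(1,∞)`. -/
lemma eq_of_fixed_points {θ γ : ℝ} (hθ : 0 < θ) (hγ : γ ∈ Ioo (0 : ℝ) (1 - θ)) {f g : ℝ → ℝ}
    (hf : MemF γ f) (hg : MemF γ g) (hTf : ∀ s, 1 ≤ s → T θ f s = f s)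
    (hTg : ∀ s, 1 ≤ s → T θ g s = g s) {s : ℝ} (hs : 1 < s) : f s = g s := by
  set S := (fun t => (t - 1) ^ γ * |f t - g t|) '' Ioi 1
  have hbdd : BddAbove S := by
    obtain ⟨A, hA⟩ := hf.2.2
    obtain ⟨B, hB⟩ := hg.2.2
    refine ⟨A + B, ?_⟩
    rintro _ ⟨t, ht, rfl⟩
    have ht : 1 < t := ht
    have h1 := hA ⟨t, ht.le, rfl⟩
    have h2 := hB ⟨t, ht.le, rfl⟩
    calc (t - 1) ^ γ * |f t - g t| ≤ t ^ γ * (|f t| + |g t|) := by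
          gcongr
          · exact hγ.1.le
          · linarith
          · exact norm_sub_le (f t) (g t)
      _ ≤ A + B := by simp only at h1 h2; linarith
  have hne : S.Nonempty := ⟨_, 2, by norm_num, rfl⟩
  have hle : ∀ t, 1 < t → (t - 1) ^ γ * |f t - g t| ≤ sSup S := fun t ht =>
    le_csSup hbdd ⟨t, ht, rfl⟩
  have hcontr : sSup S ≤ sSup S * ∫ u in Ioi (0 : ℝ), θ * (1 + u) ^ (-θ - 1) * u ^ (-γ) := by
    refine csSup_le hne ?_
    rintro _ ⟨t, ht, rfl⟩
    have ht : 1 < t := ht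
    simp only
    rw [← hTf t ht.le, ← hTg t ht.le, T_sub_T hf hg hθ ht.le]
    exact abs_integral_operator_le hθ hγ hle ht
  have hsup : sSup S ≤ 0 := by
    by_contra! hpos
    nlinarith [integral_kernel_lt_one hθ hγ]
  have hpow : 0 < (s - 1) ^ γ := rpow_pos_of_pos (by linarith) _
  have habs : |f s - g s| ≤ 0 := nonpos_of_mul_nonpos_right ((hle s hs).trans hsup) hpow
  exact sub_eq_zero.1 (abs_nonpos_iff.1 habs)

/-- For `θ ∈ (0,1)` and `α, β ∈ (0, 1−θ)`, a fixed point of `T`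
in `F_α` and a fixed point of `T` in `F_β` agree almost everywhere on `[1,∞)`:
the fixed point does not depend on the choice of the exponent. -/
theorem fixed_point_independent_of_alpha (θ α β : ℝ) (hθ : θ ∈ Ioo (0 : ℝ) 1)
    (hα : α ∈ Ioo (0 : ℝ) (1 - θ)) (hβ : β ∈ Ioo (0 : ℝ) (1 - θ))
    (fα fβ : ℝ → ℝ) (hfα : MemF α fα) (hfβ : MemF β fβ)
    (hfixα : ∀ s, 1 ≤ s → T θ fα s = fα s)
    (hfixβ : ∀ s, 1 ≤ s → T θ fβ s = fβ s) :
    ∀ᵐ s ∂(volume.restrict (Ici (1 : ℝ))), fα s = fβ s := by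
  have hmin : min α β ∈ Ioo (0 : ℝ) (1 - θ) :=
    ⟨lt_min hα.1 hβ.1, (min_le_left _ _).trans_lt hα.2⟩
  rw [← Measure.restrict_congr_set Ioi_ae_eq_Ici]
  filter_upwards [ae_restrict_mem measurableSet_Ioi] with s hs
  exact eq_of_fixed_points hθ.1 hmin (hfα.mono (min_le_left _ _)) (hfβ.mono (min_le_right _ _))
    hfixα hfixβ hs
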